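/- arXiv:2405.10710 — 2 statements merged into one kernel-verified Lean document; each statement's English description precedes it below -/
import Mathlib

section
/- Let q be any prime power and F = GF(q). Let y ∈ F^6 be nonzero with rank(M_y) = 1. Then among the q^4+q^3+q^2+q+1 conics of the squab S_y there are exactly q+1 double lines, exactly q^3 + (3q^2+q)/2 pairs of real lines, exactly (q^2−q)/2 pairs of imaginary lines, and exactly q^4−q^2 nonsingular conics. -/
open Matrix

namespace Conics

/-- Coefficient vector (a0,...,a5) of the product of two linear forms
`(b0*X0+b1*X1+b2*X2)*(c0*X0+c1*X1+c2*X2)`, where the quadratic form with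
coefficient vector `a` is `a0*X0^2 + a1*X0*X1 + a2*X0*X2 + a3*X1^2 + a4*X1*X2 + a5*X2^2`. -/
def mulLin {F : Type} [Field F] (b c : Fin 3 → F) : Fin 6 → F :=
  ![b 0 * c 0, b 0 * c 1 + b 1 * c 0, b 0 * c 2 + b 2 * c 0,
    b 1 * c 1, b 1 * c 2 + b 2 * c 1, b 2 * c 2]

/-- The discriminant of the quadratic form with coefficient vector `a`. -/
def disc {F : Type} [Field F] (a : Fin 6 → F) : F :=
  4 * a 0 * a 3 * a 5 + a 1 * a 2 * a 4 - a 0 * a 4 ^ 2 - a 3 * a 2 ^ 2 - a 5 * a 1 ^ 2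

/-- `f_a` is a double line: `f_a = c * l^2` for a nonzero scalar `c` and nonzero linear form `l`. -/
def IsDoubleLine {F : Type} [Field F] (a : Fin 6 → F) : Prop :=
  ∃ (c : F) (l : Fin 3 → F), c ≠ 0 ∧ l ≠ 0 ∧ a = c • mulLin l l

/-- `f_a` is a pair of (distinct) real lines: `f_a = l1 * l2` with neither linear form a scalar
multiple of the other. -/
def IsRealPair {F : Type} [Field F] (a : Fin 6 → F) : Prop :=
  ∃ l1 l2 : Fin 3 → F, (¬ ∃ t : F, l2 = t • l1) ∧ (¬ ∃ t : F, l1 = t • l2) ∧ a = mulLin l1 l2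

/-- `f_a` is a pair of conjugate imaginary lines: singular, but not a product of two linear
forms over `F`. -/
def IsImagPair {F : Type} [Field F] (a : Fin 6 → F) : Prop :=
  disc a = 0 ∧ ¬ ∃ l1 l2 : Fin 3 → F, a = mulLin l1 l2

/-- `f_a` is a nonsingular conic. -/
def IsNonsingular {F : Type} [Field F] (a : Fin 6 → F) : Prop :=
  disc a ≠ 0

/-- The number of conics of a given type `T` in a linear system `W` (a subspace of the space of
quadratic forms, identified with `F^6`): the number of 1-dimensional subspaces `⟨a⟩` of `W`,
`a ≠ 0`, such that `f_a` has type `T`. -/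
noncomputable def numConics {F : Type} [Field F] (W : Submodule F (Fin 6 → F))
    (T : (Fin 6 → F) → Prop) : ℕ :=
  Set.ncard {P : Submodule F (Fin 6 → F) |
    ∃ a : Fin 6 → F, a ≠ 0 ∧ a ∈ W ∧ T a ∧ P = Submodule.span F {a}}

/-- The symmetric 3×3 matrix associated with a point `y` of `PG(5,q)`. -/
def M {F : Type} [Field F] (y : Fin 6 → F) : Matrix (Fin 3) (Fin 3) F :=
  !![y 0, y 1, y 2; y 1, y 3, y 4; y 2, y 4, y 5]

/-- The pairing `B(a,y) = a0*y0 + ... + a5*y5`. -/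
def Bform {F : Type} [Field F] (a y : Fin 6 → F) : F :=
  a 0 * y 0 + a 1 * y 1 + a 2 * y 2 + a 3 * y 3 + a 4 * y 4 + a 5 * y 5

/-- The squab of conics associated with a (nonzero) point `y`: the hyperplane
`{a : B(a,y) = 0}` of the space of quadratic forms. -/
def squab {F : Type} [Field F] (y : Fin 6 → F) : Submodule F (Fin 6 → F) where
  carrier := {a | Bform a y = 0}
  add_mem' := by
    intro a b ha hb
    simp only [Set.mem_setOf_eq, Bform, Pi.add_apply] at *
    linear_combination ha + hb
  zero_mem' := by simp [Bform]
  smul_mem' := by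
    intro c a ha
    simp only [Set.mem_setOf_eq, Bform, Pi.smul_apply, smul_eq_mul] at *
    linear_combination c * ha


theorem numConics_eq {F : Type} [Field F] {R : Type} [Fintype R]
    (W : Submodule F (Fin 6 → F)) (T : (Fin 6 → F) → Prop) (r : R → Fin 6 → F)
    (h0 : ∀ i, r i ≠ 0) (hW : ∀ i, r i ∈ W) (hT : ∀ i, T (r i))
    (hinj : ∀ i j (c : F), r i = c • r j → i = j)
    (hsurj : ∀ a, a ≠ 0 → a ∈ W → T a → ∃ i, ∃ c : F, c ≠ 0 ∧ a = c • r i) :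
    numConics W T = Fintype.card R := by
  have hs : {P : Submodule F (Fin 6 → F) |
      ∃ a : Fin 6 → F, a ≠ 0 ∧ a ∈ W ∧ T a ∧ P = Submodule.span F {a}} =
      (fun i => Submodule.span F {r i}) '' Set.univ := by
    ext P
    constructor
    · rintro ⟨a, ha, haW, haT, rfl⟩
      obtain ⟨i, c, hc, rfl⟩ := hsurj a ha haW haT
      exact ⟨i, trivial, (Submodule.span_singleton_smul_eq (IsUnit.mk0 c hc) _).symm⟩
    · rintro ⟨i, -, rfl⟩
      exact ⟨r i, h0 i, hW i, hT i, rfl⟩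
  unfold numConics
  rw [hs, Set.ncard_image_of_injective, Set.ncard_univ, Nat.card_eq_fintype_card]
  intro i j hij
  have : r i ∈ Submodule.span F {r j} := by
    have h := Submodule.mem_span_singleton_self (R := F) (r i)
    simp only at hij
    rwa [hij] at h
  obtain ⟨c, hc⟩ := Submodule.mem_span_singleton.1 this
  exact hinj i j c hc.symm

/-- Points of the line at the base point: linear forms vanishing at `(1,0,0)`. -/
def pt {F : Type} [Field F] : Option F → Fin 3 → F
  | some s => ![0, 1, s]
  | none => ![0, 0, 1]

/-- The normalised rank one point. -/
def y1 {F : Type} [Field F] : Fin 6 → F := ![1, 0, 0, 0, 0, 0]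

theorem mem_y1 {F : Type} [Field F] (a : Fin 6 → F) : a ∈ squab (y1 : Fin 6 → F) ↔ a 0 = 0 := by
  change Bform a y1 = 0 ↔ _
  simp [Bform, y1]

theorem ext6 {F : Type} {a b : Fin 6 → F} : a = b ↔
    a 0 = b 0 ∧ a 1 = b 1 ∧ a 2 = b 2 ∧ a 3 = b 3 ∧ a 4 = b 4 ∧ a 5 = b 5 := by
  constructor
  · rintro rfl; simp
  · rintro ⟨h0, h1, h2, h3, h4, h5⟩
    ext i; fin_cases i <;> assumption

theorem ext3 {F : Type} {a b : Fin 3 → F} : a = b ↔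
    a 0 = b 0 ∧ a 1 = b 1 ∧ a 2 = b 2 := by
  constructor
  · rintro rfl; simp
  · rintro ⟨h0, h1, h2⟩
    ext i; fin_cases i <;> assumption

theorem exists_pt {F : Type} [Field F] (l : Fin 3 → F) (h0 : l 0 = 0) (hl : l ≠ 0) :
    ∃ u, ∃ c : F, c ≠ 0 ∧ l = c • pt u := by
  by_cases h1 : l 1 = 0
  · refine ⟨none, l 2, ?_, ?_⟩
    · intro h2; apply hl; rw [ext3]; simp [h0, h1, h2]
    · rw [ext3]; simp [pt, h0, h1]
  · refine ⟨some (l 2 / l 1), l 1, h1, ?_⟩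
    rw [ext3]; simp [pt, h0]; field_simp

theorem pt_ne {F : Type} [Field F] (u : Option F) : pt u ≠ 0 := by
  cases u <;> simp [pt, ext3]

theorem pt_zero {F : Type} [Field F] (u : Option F) : pt u 0 = 0 := by
  cases u <;> simp [pt]

theorem mulLin_smul {F : Type} [Field F] (c d : F) (l m : Fin 3 → F) :
    mulLin (c • l) (d • m) = (c * d) • mulLin l m := by
  rw [ext6]; simp [mulLin]; refine ⟨?_, ?_, ?_, ?_, ?_, ?_⟩ <;> ring

theorem mulLin_comm {F : Type} [Field F] (l m : Fin 3 → F) :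
    mulLin l m = mulLin m l := by
  rw [ext6]; simp [mulLin]; refine ⟨?_, ?_, ?_, ?_, ?_, ?_⟩ <;> ring

theorem pt_inj {F : Type} [Field F] (u v : Option F) (c : F) (h : pt u = c • pt v) : u = v := by
  cases u <;> cases v <;> simp [pt, ext3] at h ⊢ <;> grind

theorem mulLin_ne {F : Type} [Field F] (u : Option F) (m : Fin 3 → F) (hm : m ≠ 0) :
    mulLin (pt u) m ≠ 0 := by
  intro h; apply hm
  cases u <;> simp [pt, ext3, ext6, mulLin] at h ⊢ <;> grind

section base
variable {F : Type} [Field F] [Fintype F]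

theorem count_double : numConics (squab (y1 : Fin 6 → F)) IsDoubleLine = Fintype.card F + 1 := by
  rw [← Fintype.card_option]
  apply numConics_eq _ _ (fun u : Option F => mulLin (pt u) (pt u))
  · intro u; exact mulLin_ne _ _ (pt_ne u)
  · intro u; rw [mem_y1]; simp [mulLin, pt_zero]
  · intro u; exact ⟨1, pt u, one_ne_zero, pt_ne u, by simp⟩
  · intro u v c h
    cases u <;> cases v <;> simp [pt, ext6, mulLin] at h ⊢ <;> grind
  · rintro a ha haW ⟨c, l, hc, hl, rfl⟩
    rw [mem_y1] at haW
    have h0 : l 0 = 0 := by simpa [mulLin, hc] using haW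
    obtain ⟨u, d, hd, rfl⟩ := exists_pt l h0 hl
    refine ⟨u, c * (d * d), by simp [hc, hd], ?_⟩
    rw [mulLin_smul, smul_smul]

theorem count_nonsing : numConics (squab (y1 : Fin 6 → F)) IsNonsingular =
    Fintype.card F ^ 4 - Fintype.card F ^ 2 := by
  classical
  have hc : Fintype.card (Option F × F × F × Fˣ) = Fintype.card F ^ 4 - Fintype.card F ^ 2 := by
    simp only [Fintype.card_prod, Fintype.card_option, Fintype.card_units]
    have := Fintype.card_pos (α := F)
    obtain ⟨k, hk⟩ := Nat.exists_eq_add_of_le this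
    rw [hk, Nat.succ_eq_add_one, zero_add, Nat.add_sub_cancel_left]
    symm; apply Nat.sub_eq_of_eq_add; ring
  rw [← hc]
  apply numConics_eq _ _ (fun x : Option F × F × F × Fˣ => match x with
    | (some s, a, b, d) => ![0, 1, s, a, b, s * b - s ^ 2 * a - d]
    | (none, a, b, d) => ![0, 0, 1, d, a, b])
  · rintro ⟨_ | s, a, b, d⟩ <;> simp [ext6]
  · rintro ⟨_ | s, a, b, d⟩ <;> simp [mem_y1]
  · rintro ⟨_ | s, a, b, d⟩
    · simp [IsNonsingular, disc]
    · have := d.ne_zero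
      simp only [IsNonsingular, disc]
      simp
      intro h
      apply this
      linear_combination h
  · rintro ⟨_ | s, a, b, d⟩ ⟨_ | s', a', b', d'⟩ c h <;> simp [ext6, Units.ext_iff] at h ⊢ <;> grind
  · intro a ha haW hT
    rw [mem_y1] at haW
    by_cases h1 : a 1 = 0
    · have h2 : a 2 ≠ 0 := by
        intro h2; apply hT; simp [disc, haW, h1, h2]
      have h3 : a 3 ≠ 0 := by
        intro h3; apply hT; simp [disc, haW, h1, h3]
      refine ⟨(none, a 4 / a 2, a 5 / a 2, Units.mk0 (a 3 / a 2) (by positivity)), a 2, h2, ?_⟩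
      simp [ext6, haW, h1]; field_simp; simp
    · have hT' : a 1 * a 2 * a 4 - a 3 * a 2 ^ 2 - a 5 * a 1 ^ 2 ≠ 0 := by
        intro h; apply hT; simp only [disc, haW]; linear_combination h
      refine ⟨(some (a 2 / a 1), a 3 / a 1, a 4 / a 1, Units.mk0
        ((a 1 * a 2 * a 4 - a 3 * a 2 ^ 2 - a 5 * a 1 ^ 2) / a 1 ^ 3)
        (div_ne_zero hT' (pow_ne_zero _ h1))), a 1, h1, ?_⟩
      simp [ext6, haW]; field_simp; simp

/-- Representatives for pairs of lines through the base point. -/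
def two : Sym2 (Option F) → Fin 6 → F :=
  Sym2.lift ⟨fun u v => mulLin (pt u) (pt v), fun u v => mulLin_comm _ _⟩

theorem real_card (q : ℕ) : (q + 1) * (q * q) + (q + 1).choose 2 = q ^ 3 + (3 * q ^ 2 + q) / 2 := by
  rw [Nat.choose_two_right]
  obtain ⟨k, hk⟩ := (Nat.even_mul_succ_self q).two_dvd
  have h1 : (q + 1) * (q + 1 - 1) = 2 * k := by rw [← hk]; simp; ring
  have h2 : 3 * q ^ 2 + q = 2 * (q ^ 2 + k) := by linarith
  rw [h1, h2, Nat.mul_div_cancel_left _ two_pos, Nat.mul_div_cancel_left _ two_pos]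
  ring

theorem count_real : numConics (squab (y1 : Fin 6 → F)) IsRealPair =
    Fintype.card F ^ 3 + (3 * Fintype.card F ^ 2 + Fintype.card F) / 2 := by
  classical
  have hc : Fintype.card ((Option F × F × F) ⊕ {z : Sym2 (Option F) // ¬ z.IsDiag}) =
      Fintype.card F ^ 3 + (3 * Fintype.card F ^ 2 + Fintype.card F) / 2 := by
    rw [Fintype.card_sum, Sym2.card_subtype_not_diag]
    simp only [Fintype.card_prod, Fintype.card_option]
    exact real_card _
  rw [← hc]
  apply numConics_eq _ _ (fun x : (Option F × F × F) ⊕ {z : Sym2 (Option F) // ¬ z.IsDiag} =>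
    match x with
    | Sum.inl (u, m, n) => mulLin (pt u) ![1, m, n]
    | Sum.inr z => two z.1)
  · rintro (⟨u, m, n⟩ | ⟨z, hz⟩)
    · exact mulLin_ne _ _ (by simp [ext3])
    · induction z using Sym2.ind with | _ u v => exact mulLin_ne _ _ (pt_ne v)
  · rintro (⟨u, m, n⟩ | ⟨z, hz⟩)
    · simp [mem_y1, mulLin, pt_zero]
    · induction z using Sym2.ind with | _ u v => simp [mem_y1, two, mulLin, pt_zero]
  · rintro (⟨u, m, n⟩ | ⟨z, hz⟩)
    · refine ⟨pt u, ![1, m, n], ?_, ?_, rfl⟩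
      · rintro ⟨t, ht⟩
        have := congrFun ht 0
        simp [pt_zero] at this
      · rintro ⟨t, ht⟩
        have := congrFun ht 0
        simp [pt_zero] at this
        exact pt_ne u (by rw [ht, ← this]; simp)
    · induction z using Sym2.ind with
      | _ u v =>
        refine ⟨pt u, pt v, ?_, ?_, rfl⟩
        · rintro ⟨t, ht⟩
          exact hz (pt_inj _ _ _ ht).symm
        · rintro ⟨t, ht⟩
          exact hz (pt_inj _ _ _ ht)
  · rintro (⟨u, m, n⟩ | ⟨z, hz⟩) (⟨u', m', n'⟩ | ⟨z', hz'⟩) c h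
    · cases u <;> cases u' <;> simp [pt, ext6, mulLin] at h ⊢ <;> grind
    · induction z' using Sym2.ind with
      | _ u' v' =>
        exfalso
        simp only [two, Sym2.lift_mk] at h
        cases u <;> cases u' <;> cases v' <;> simp [pt, ext6, mulLin] at h
    · induction z using Sym2.ind with
      | _ u v =>
        exfalso
        simp only [two, Sym2.lift_mk] at h
        cases u <;> cases u' <;> cases v <;> simp [pt, ext6, mulLin] at h <;> grind
    · induction z using Sym2.ind with
      | _ u v =>
      induction z' using Sym2.ind with
      | _ u' v' =>
        simp only [two, Sym2.lift_mk] at h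
        simp only [Sym2.isDiag_iff_proj_eq] at hz hz'
        cases u <;> cases u' <;> cases v <;> cases v' <;>
          simp [pt, ext6, mulLin] at h hz hz' ⊢ <;> grind
  · rintro a ha haW ⟨l, m, h1, h2, rfl⟩
    rw [mem_y1] at haW
    have key : ∀ l m : Fin 3 → F, (¬ ∃ t : F, m = t • l) → (¬ ∃ t : F, l = t • m) → l 0 = 0 →
        ∃ i : (Option F × F × F) ⊕ {z : Sym2 (Option F) // ¬ z.IsDiag}, ∃ c : F, c ≠ 0 ∧
          mulLin l m = c • (match i with
            | Sum.inl (u, m, n) => mulLin (pt u) ![1, m, n]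
            | Sum.inr z => two z.1) := by
      intro l m h1 h2 hl0
      have hl : l ≠ 0 := by rintro rfl; exact h2 ⟨0, by simp⟩
      have hm : m ≠ 0 := by rintro rfl; exact h1 ⟨0, by simp⟩
      obtain ⟨u, d, hd, rfl⟩ := exists_pt l hl0 hl
      by_cases hm0 : m 0 = 0
      · obtain ⟨v, e, he, rfl⟩ := exists_pt m hm0 hm
        refine ⟨Sum.inr ⟨s(u, v), ?_⟩, d * e, mul_ne_zero hd he, mulLin_smul _ _ _ _⟩
        simp only [Sym2.isDiag_iff_proj_eq]
        rintro rfl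
        exact h1 ⟨e / d, by rw [smul_smul, div_mul_cancel₀ _ hd]⟩
      · refine ⟨Sum.inl (u, m 1 / m 0, m 2 / m 0), d * m 0, mul_ne_zero hd hm0, ?_⟩
        simp only
        rw [← mulLin_smul]
        congr 1
        rw [ext3]; simp; field_simp; simp
    have h0 : l 0 * m 0 = 0 := by simpa [mulLin] using haW
    rcases mul_eq_zero.1 h0 with h | h
    · exact key l m h1 h2 h
    · rw [mulLin_comm]; exact key m l h2 h1 h

/-- Elementary symmetric functions of an unordered pair. -/
def esym : Sym2 F → F × F :=
  Sym2.lift ⟨fun u v => (u + v, u * v), fun u v => by simp only [add_comm u, mul_comm u]⟩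

theorem esym_inj : Function.Injective (esym : Sym2 F → F × F) := by
  intro z z' h
  induction z using Sym2.ind with
  | _ u v =>
  induction z' using Sym2.ind with
  | _ u' v' =>
    simp [esym] at h ⊢
    grind

theorem imag_card (q : ℕ) : q * q - (q + 1).choose 2 = (q ^ 2 - q) / 2 := by
  rw [Nat.choose_two_right]
  obtain ⟨k, hk⟩ := (Nat.even_mul_succ_self q).two_dvd
  have h1 : (q + 1) * (q + 1 - 1) = 2 * k := by rw [← hk]; simp; ring
  rw [h1, Nat.mul_div_cancel_left _ two_pos]
  have : q * (q + 1) = q ^ 2 + q := by ring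
  have : q * q = q ^ 2 := by ring
  have : q ≤ q ^ 2 := by nlinarith
  omega

theorem count_imag : numConics (squab (y1 : Fin 6 → F)) IsImagPair =
    (Fintype.card F ^ 2 - Fintype.card F) / 2 := by
  classical
  have hc : Fintype.card {p : F × F // ¬ p ∈ Set.range (esym (F := F))} =
      (Fintype.card F ^ 2 - Fintype.card F) / 2 := by
    rw [Fintype.card_subtype_compl, Fintype.card_prod]
    have : Fintype.card {p : F × F // p ∈ Set.range (esym (F := F))} = Fintype.card (Sym2 F) :=
      Set.card_range_of_injective esym_inj
    rw [this, Sym2.card, imag_card]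
  rw [← hc]
  apply numConics_eq _ _ (fun p : {p : F × F // ¬ p ∈ Set.range (esym (F := F))} =>
    ![0, 0, 0, 1, p.1.1, p.1.2])
  · intro p; simp [ext6]
  · intro p; simp [mem_y1]
  · rintro ⟨p, hp⟩
    refine ⟨by simp [disc], ?_⟩
    rintro ⟨l, m, h⟩
    apply hp
    simp [ext6, mulLin] at h
    obtain ⟨h0, h1, h2, h3, h4, h5⟩ := h
    have hl : l 1 ≠ 0 := by intro h; simp [h] at h3
    have hm : m 1 ≠ 0 := by intro h; simp [h] at h3
    refine ⟨s(l 2 / l 1, m 2 / m 1), ?_⟩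
    simp only [esym, Sym2.lift_mk]
    ext
    · simp only [h4]; field_simp; linear_combination (l 1 * m 2 + l 2 * m 1) * h3
    · simp only [h5]; field_simp; linear_combination l 2 * m 2 * h3
  · rintro ⟨⟨p1, p2⟩, hp⟩ ⟨⟨q1, q2⟩, hq⟩ c h
    simp [ext6] at h ⊢
    grind
  · rintro a ha haW ⟨hd, hp⟩
    rw [mem_y1] at haW
    have hd' : a 1 * a 2 * a 4 - a 3 * a 2 ^ 2 - a 5 * a 1 ^ 2 = 0 := by
      simp only [disc, haW] at hd; linear_combination hd
    have h1 : a 1 = 0 := by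
      by_contra h1
      apply hp
      refine ⟨![0, a 1, a 2], ![1, a 3 / a 1, (a 4 - a 2 * a 3 / a 1) / a 1], ?_⟩
      simp [ext6, mulLin, haW]
      refine ⟨?_, ?_, ?_⟩
      · field_simp
      · field_simp; ring
      · field_simp; linear_combination -hd'
    have h2 : a 2 = 0 := by
      by_contra h2
      apply hp
      have h3 : a 3 = 0 := by simpa [h1, h2] using hd'
      refine ⟨![0, 0, a 2], ![1, a 4 / a 2, a 5 / a 2], ?_⟩
      simp [ext6, mulLin, haW, h1, h3]
      constructor <;> field_simp
    have h3 : a 3 ≠ 0 := by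
      intro h3
      apply hp
      refine ⟨![0, 0, 1], ![0, a 4, a 5], ?_⟩
      simp [ext6, mulLin, haW, h1, h2, h3]
    refine ⟨⟨(a 4 / a 3, a 5 / a 3), ?_⟩, a 3, h3, ?_⟩
    · rintro ⟨z, hz⟩
      induction z using Sym2.ind with
      | _ u v =>
        simp [esym] at hz
        obtain ⟨e1, e2⟩ := hz
        apply hp
        refine ⟨![0, a 3, a 3 * u], ![0, 1, v], ?_⟩
        simp [ext6, mulLin, haW, h1, h2]
        rw [eq_div_iff h3] at e1 e2
        constructor
        · linear_combination -e1
        · linear_combination -e2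
    · simp [ext6, haW, h1, h2]; constructor <;> field_simp

end base

section transfer
variable {F : Type} [Field F]

theorem numConics_transfer (W W' : Submodule F (Fin 6 → F)) (T : (Fin 6 → F) → Prop)
    (e : (Fin 6 → F) ≃ₗ[F] (Fin 6 → F)) (hW : ∀ a, e a ∈ W' ↔ a ∈ W) (hT : ∀ a, T (e a) ↔ T a) :
    numConics W T = numConics W' T := by
  unfold numConics
  rw [← Set.ncard_image_of_injective _
    (Submodule.map_injective_of_injective (f := e.toLinearMap) e.injective)]
  congr 1
  ext P
  constructor
  · rintro ⟨_, ⟨a, ha, haW, haT, rfl⟩, rfl⟩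
    refine ⟨e a, by simpa using ha, (hW a).2 haW, (hT a).2 haT, ?_⟩
    rw [Submodule.map_span]; simp
  · rintro ⟨a, ha, haW, haT, rfl⟩
    obtain ⟨b, rfl⟩ := e.surjective a
    refine ⟨_, ⟨b, by simpa using ha, (hW b).1 haW, (hT b).1 haT, rfl⟩, ?_⟩
    rw [Submodule.map_span]; simp

/-- The conclusion of the main theorem. -/
def Concl [Fintype F] (y : Fin 6 → F) (q : ℕ) : Prop :=
    numConics (squab y) IsDoubleLine = q + 1 ∧
    numConics (squab y) IsRealPair = q ^ 3 + (3 * q ^ 2 + q) / 2 ∧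
    numConics (squab y) IsImagPair = (q ^ 2 - q) / 2 ∧
    numConics (squab y) IsNonsingular = q ^ 4 - q ^ 2

theorem Concl_transfer [Fintype F] (y y' : Fin 6 → F) (q : ℕ)
    (e : (Fin 6 → F) ≃ₗ[F] (Fin 6 → F)) (g : (Fin 3 → F) ≃ₗ[F] (Fin 3 → F))
    (hW : ∀ a, Bform (e a) y' = 0 ↔ Bform a y = 0)
    (hm : ∀ l m, e (mulLin l m) = mulLin (g l) (g m))
    (hd : ∀ a, disc (e a) = disc a) (h : Concl y' q) : Concl y q := by
  have hm' : ∀ a l m, e a = mulLin l m ↔ a = mulLin (g.symm l) (g.symm m) := by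
    intro a l m
    rw [← e.injective.eq_iff (a := a), hm]; simp
  have hm1 : ∀ l m, e (mulLin l m) = mulLin (g l) (g m) := hm
  have hW' : ∀ a, e a ∈ squab y' ↔ a ∈ squab y := hW
  unfold Concl at *
  rw [numConics_transfer (squab y) (squab y') IsDoubleLine e hW',
    numConics_transfer (squab y) (squab y') IsRealPair e hW',
    numConics_transfer (squab y) (squab y') IsImagPair e hW',
    numConics_transfer (squab y) (squab y') IsNonsingular e hW']
  · exact h
  · intro a; simp [IsNonsingular, hd]
  · intro a
    unfold IsImagPair
    rw [hd]
    refine and_congr_right fun _ => not_congr ⟨?_, ?_⟩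
    · rintro ⟨l, m, h⟩; exact ⟨_, _, (hm' _ _ _).1 h⟩
    · rintro ⟨l, m, rfl⟩; exact ⟨_, _, hm _ _⟩
  · intro a
    constructor
    · rintro ⟨l, m, h1, h2, h⟩
      refine ⟨_, _, ?_, ?_, (hm' _ _ _).1 h⟩
      · rintro ⟨t, ht⟩; exact h1 ⟨t, g.symm.injective (by rw [ht, map_smul])⟩
      · rintro ⟨t, ht⟩; exact h2 ⟨t, g.symm.injective (by rw [ht, map_smul])⟩
    · rintro ⟨l, m, h1, h2, rfl⟩
      refine ⟨_, _, ?_, ?_, hm _ _⟩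
      · rintro ⟨t, ht⟩; exact h1 ⟨t, g.injective (by rw [ht, map_smul])⟩
      · rintro ⟨t, ht⟩; exact h2 ⟨t, g.injective (by rw [ht, map_smul])⟩
  · intro a
    constructor
    · rintro ⟨c, l, hc, hl, h⟩
      refine ⟨c, g.symm l, hc, by simpa using hl, ?_⟩
      apply e.injective
      rw [h, map_smul, hm]; simp
    · rintro ⟨c, l, hc, hl, rfl⟩
      exact ⟨c, g l, hc, by simpa using hl, by rw [map_smul, hm]⟩

/-- Shear on quadratic forms. -/
def shear (s t : F) : (Fin 6 → F) →ₗ[F] (Fin 6 → F) where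
  toFun a := ![a 0 + a 1 * s + a 2 * t + a 3 * s ^ 2 + a 4 * s * t + a 5 * t ^ 2,
    a 1 + 2 * s * a 3 + t * a 4, a 2 + s * a 4 + 2 * t * a 5, a 3, a 4, a 5]
  map_add' a b := by simp [ext6]; refine ⟨?_, ?_, ?_⟩ <;> ring
  map_smul' c a := by simp [ext6]; refine ⟨?_, ?_, ?_⟩ <;> ring

/-- Shear on linear forms. -/
def shear3 (s t : F) : (Fin 3 → F) →ₗ[F] (Fin 3 → F) where
  toFun a := ![a 0 + a 1 * s + a 2 * t, a 1, a 2]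
  map_add' a b := by simp [ext3]; ring
  map_smul' c a := by simp [ext3]; ring

/-- Invertible shear on quadratic forms. -/
def shearE (s t : F) : (Fin 6 → F) ≃ₗ[F] (Fin 6 → F) :=
  LinearEquiv.ofLinear (shear s t) (shear (-s) (-t))
    (by apply LinearMap.ext; intro a; simp [shear, ext6]; refine ⟨?_, ?_, ?_⟩ <;> ring)
    (by apply LinearMap.ext; intro a; simp [shear, ext6]; refine ⟨?_, ?_, ?_⟩ <;> ring)

/-- Invertible shear on linear forms. -/
def shear3E (s t : F) : (Fin 3 → F) ≃ₗ[F] (Fin 3 → F) :=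
  LinearEquiv.ofLinear (shear3 s t) (shear3 (-s) (-t))
    (by apply LinearMap.ext; intro a; simp [shear3, ext3]; ring)
    (by apply LinearMap.ext; intro a; simp [shear3, ext3]; ring)

/-- Exchange of the first two coordinates. -/
def swA : (Fin 6 → F) →ₗ[F] (Fin 6 → F) where
  toFun a := ![a 3, a 1, a 4, a 0, a 2, a 5]
  map_add' a b := by simp [ext6]
  map_smul' c a := by simp [ext6]

/-- Exchange of the first two coordinates, linear forms. -/
def swA3 : (Fin 3 → F) →ₗ[F] (Fin 3 → F) where
  toFun a := ![a 1, a 0, a 2]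
  map_add' a b := by simp [ext3]
  map_smul' c a := by simp [ext3]

/-- Exchange of the first and last coordinates. -/
def swB : (Fin 6 → F) →ₗ[F] (Fin 6 → F) where
  toFun a := ![a 5, a 4, a 2, a 3, a 1, a 0]
  map_add' a b := by simp [ext6]
  map_smul' c a := by simp [ext6]

/-- Exchange of the first and last coordinates, linear forms. -/
def swB3 : (Fin 3 → F) →ₗ[F] (Fin 3 → F) where
  toFun a := ![a 2, a 1, a 0]
  map_add' a b := by simp [ext3]
  map_smul' c a := by simp [ext3]

/-- An involutive linear map as an equivalence. -/
def invE {n : ℕ} (f : (Fin n → F) →ₗ[F] (Fin n → F)) (h : ∀ a, f (f a) = a) :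
    (Fin n → F) ≃ₗ[F] (Fin n → F) :=
  LinearEquiv.ofLinear f f (LinearMap.ext h) (LinearMap.ext h)

variable [Fintype F]

/-- All two by two minors of the symmetric matrix vanish (the ones that are needed). -/
def Minors (y : Fin 6 → F) : Prop :=
  y 0 * y 3 = y 1 ^ 2 ∧ y 0 * y 5 = y 2 ^ 2 ∧ y 3 * y 5 = y 4 ^ 2 ∧ y 0 * y 4 = y 1 * y 2 ∧
    y 3 * y 2 = y 1 * y 4 ∧ y 5 * y 1 = y 2 * y 4

theorem concl_of_y0 (y : Fin 6 → F) (h : Minors y) (h0 : y 0 ≠ 0) :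
    Concl y (Fintype.card F) := by
  obtain ⟨m1, m2, m3, m4, m5, m6⟩ := h
  apply Concl_transfer y y1 _ (shearE (y 1 / y 0) (y 2 / y 0)) (shear3E (y 1 / y 0) (y 2 / y 0))
  · intro a
    have : Bform a y = y 0 * Bform (shearE (y 1 / y 0) (y 2 / y 0) a) y1 := by
      simp [Bform, shearE, shear, y1]
      field_simp
      linear_combination a 3 * m1 + a 4 * m4 + a 5 * m2
    rw [this]; simp [h0]
  · intro l m
    simp [shearE, shear3E, shear, shear3, mulLin, ext6]
    refine ⟨?_, ?_, ?_⟩ <;> ring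
  · intro a
    simp [shearE, shear, disc]; ring
  · exact ⟨count_double, count_real, count_imag, count_nonsing⟩

theorem concl_of_minors (y : Fin 6 → F) (h : Minors y) (hy : y ≠ 0) :
    Concl y (Fintype.card F) := by
  by_cases h0 : y 0 = 0
  · have h' := h
    obtain ⟨m1, m2, m3, m4, m5, m6⟩ := h
    by_cases h3 : y 3 = 0
    · have h5 : y 5 ≠ 0 := by
        intro h5; apply hy
        have n1 : y 1 = 0 := by rw [h0, zero_mul] at m1; exact pow_eq_zero_iff two_ne_zero |>.1 m1.symm
        have n2 : y 2 = 0 := by rw [h0, zero_mul] at m2; exact pow_eq_zero_iff two_ne_zero |>.1 m2.symm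
        have n4 : y 4 = 0 := by rw [h3, zero_mul] at m3; exact pow_eq_zero_iff two_ne_zero |>.1 m3.symm
        rw [ext6]; exact ⟨h0, n1, n2, h3, n4, h5⟩
      apply Concl_transfer y (swB y) _ (invE swB (by intro a; simp [swB, ext6]))
        (invE swB3 (by intro a; simp [swB3, ext3]))
      · intro a
        have : Bform (swB a) (swB y) = Bform a y := by simp [Bform, swB]; ring
        change Bform (swB a) (swB y) = 0 ↔ _
        rw [this]
      · intro l m
        simp [invE, swB, swB3, mulLin, ext6]
        refine ⟨?_, ?_, ?_⟩ <;> ring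
      · intro a
        simp [invE, swB, disc]; ring
      · apply concl_of_y0
        · simp [Minors, swB]; grind
        · simpa [swB] using h5
    · apply Concl_transfer y (swA y) _ (invE swA (by intro a; simp [swA, ext6]))
        (invE swA3 (by intro a; simp [swA3, ext3]))
      · intro a
        have : Bform (swA a) (swA y) = Bform a y := by simp [Bform, swA]; ring
        change Bform (swA a) (swA y) = 0 ↔ _
        rw [this]
      · intro l m
        simp [invE, swA, swA3, mulLin, ext6]
        ring
      · intro a
        simp [invE, swA, disc]; ring
      · apply concl_of_y0
        · simp [Minors, swA]; grind
        · simpa [swA] using h3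
  · exact concl_of_y0 y h h0

theorem minors_of_rank (y : Fin 6 → F) (hrk : (M y).rank = 1) : Minors y := by
  rw [Matrix.rank_eq_finrank_span_cols] at hrk
  obtain ⟨⟨w, hw⟩, h⟩ := finrank_le_one_iff.1 hrk.le
  have key : ∀ j, ∃ c : F, c • w = (M y).col j := by
    intro j
    obtain ⟨c, hc⟩ := h ⟨(M y).col j, Submodule.subset_span ⟨j, rfl⟩⟩
    exact ⟨c, congrArg Subtype.val hc⟩
  obtain ⟨a, ha⟩ := key 0
  obtain ⟨b, hb⟩ := key 1
  obtain ⟨c, hc⟩ := key 2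
  rw [ext3] at ha hb hc
  simp only [M, Matrix.col, Pi.smul_apply, smul_eq_mul] at ha hb hc
  simp at ha hb hc
  unfold Minors
  grind

end transfer

/-- hyperplane-orbit distribution of a rank-1 point (squab of rank one). -/
theorem squab_rank_one_conic_counts (F : Type) [Field F] [Fintype F] (q : ℕ)
    (hq : Fintype.card F = q) (y : Fin 6 → F) (hy : y ≠ 0) (hrk : (M y).rank = 1) :
    numConics (squab y) IsDoubleLine = q + 1 ∧
    numConics (squab y) IsRealPair = q ^ 3 + (3 * q ^ 2 + q) / 2 ∧
    numConics (squab y) IsImagPair = (q ^ 2 - q) / 2 ∧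
    numConics (squab y) IsNonsingular = q ^ 4 - q ^ 2 := by
  subst hq
  exact concl_of_minors y (minors_of_rank y hrk) hy
end Conics
end

section
/- Let q be an odd prime power and F = GF(q). Let y ∈ F^6 be nonzero with rank(M_y) = 2 and y interior. Then among the conics of the squab S_y there is exactly 1 double line, exactly (q^3+3q^2)/2 + q pairs of real lines, exactly (q^3+q^2)/2 pairs of imaginary lines, and exactly q^4−q^2 nonsingular conics. -/
open Matrix

namespace Conics

/-- For `q` odd, a rank-2 point `y` is exterior if some vector `v` satisfies
`vᵀ M_y v = 0` and `M_y v ≠ 0`; a rank-2 point is interior otherwise. -/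
def IsExterior {F : Type} [Field F] (y : Fin 6 → F) : Prop :=
  ∃ v : Fin 3 → F, v ⬝ᵥ (M y).mulVec v = 0 ∧ (M y).mulVec v ≠ 0

/-- The substitution action of a matrix on quadratic forms. -/
def Phi {F : Type} [Field F] (P : Matrix (Fin 3) (Fin 3) F) (a : Fin 6 → F) : Fin 6 → F :=
  a 0 • mulLin (P.col 0) (P.col 0) + a 1 • mulLin (P.col 0) (P.col 1)
    + a 2 • mulLin (P.col 0) (P.col 2) + a 3 • mulLin (P.col 1) (P.col 1)
    + a 4 • mulLin (P.col 1) (P.col 2) + a 5 • mulLin (P.col 2) (P.col 2)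

section
variable {F : Type} [Field F]

lemma Phi_mulLin (P : Matrix (Fin 3) (Fin 3) F) (b c : Fin 3 → F) :
    Phi P (mulLin b c) = mulLin (P *ᵥ b) (P *ᵥ c) := by
  ext i
  fin_cases i <;>
  · simp [Phi, mulLin, Matrix.mulVec, dotProduct, Fin.sum_univ_three]
    ring

lemma Phi_smul (P : Matrix (Fin 3) (Fin 3) F) (c : F) (a : Fin 6 → F) :
    Phi P (c • a) = c • Phi P a := by
  ext i
  simp [Phi]
  ring

lemma Phi_add (P : Matrix (Fin 3) (Fin 3) F) (a b : Fin 6 → F) :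
    Phi P (a + b) = Phi P a + Phi P b := by
  ext i
  simp [Phi]
  ring

lemma mulVec_col (Q P : Matrix (Fin 3) (Fin 3) F) (i : Fin 3) :
    Q *ᵥ (P.col i) = (Q * P).col i := by
  ext j
  simp [Matrix.mulVec, Matrix.mul_apply, dotProduct]

lemma Phi_Phi (Q P : Matrix (Fin 3) (Fin 3) F) (a : Fin 6 → F) :
    Phi Q (Phi P a) = Phi (Q * P) a := by
  conv_lhs => rw [Phi.eq_def P]
  simp only [Phi_add, Phi_smul, Phi_mulLin, mulVec_col]
  rfl

lemma Phi_one (a : Fin 6 → F) : Phi 1 a = a := by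
  ext i
  fin_cases i <;> simp [Phi, mulLin]

lemma Phi_inv {Q P : Matrix (Fin 3) (Fin 3) F} (h : Q * P = 1) (a : Fin 6 → F) :
    Phi Q (Phi P a) = a := by
  rw [Phi_Phi, h, Phi_one]

lemma disc_Phi (P : Matrix (Fin 3) (Fin 3) F) (a : Fin 6 → F) :
    disc (Phi P a) = P.det ^ 2 * disc a := by
  simp [Phi, mulLin, disc, Matrix.det_fin_three]
  ring

lemma Bform_add (a b y : Fin 6 → F) : Bform (a + b) y = Bform a y + Bform b y := by
  simp [Bform]; ring

lemma Bform_smul (c : F) (a y : Fin 6 → F) : Bform (c • a) y = c * Bform a y := by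
  simp [Bform]; ring

lemma Bform_mulLin (b c y : Fin 3 → F) (y : Fin 6 → F) :
    Bform (mulLin b c) y = b ⬝ᵥ (M y *ᵥ c) := by
  simp [Bform, mulLin, M, Matrix.mulVec, dotProduct, Fin.sum_univ_three]
  ring

lemma M_symm (b c : Fin 3 → F) (y : Fin 6 → F) :
    b ⬝ᵥ (M y *ᵥ c) = c ⬝ᵥ (M y *ᵥ b) := by
  simp [M, Matrix.mulVec, dotProduct, Fin.sum_univ_three]
  ring

/-- Invariance of a type of conics. -/
structure Inv (T : (Fin 6 → F) → Prop) : Prop where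
  phi : ∀ P Q : Matrix (Fin 3) (Fin 3) F, Q * P = 1 → ∀ a, T a → T (Phi P a)
  smul : ∀ c : F, c ≠ 0 → ∀ a, T a → T (c • a)

lemma mulVec_inv {Q P : Matrix (Fin 3) (Fin 3) F} (h : Q * P = 1) (v : Fin 3 → F) :
    Q *ᵥ (P *ᵥ v) = v := by
  rw [Matrix.mulVec_mulVec, h, Matrix.one_mulVec]

lemma smul_mulLin (c : F) (a b : Fin 3 → F) : c • mulLin a b = mulLin (c • a) b := by
  ext i
  fin_cases i <;> simp [mulLin] <;> ring

lemma det_ne {Q P : Matrix (Fin 3) (Fin 3) F} (h : Q * P = 1) : P.det ≠ 0 := by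
  intro h0
  have := congrArg Matrix.det h
  rw [Matrix.det_mul, h0] at this
  simp at this

lemma inv_double : Inv (F := F) IsDoubleLine where
  phi := by
    rintro P Q h a ⟨c, l, hc, hl, rfl⟩
    refine ⟨c, P *ᵥ l, hc, ?_, ?_⟩
    · intro h0
      apply hl
      rw [← mulVec_inv h l, h0, Matrix.mulVec_zero]
    · rw [Phi_smul, Phi_mulLin]
  smul := by
    rintro d hd a ⟨c, l, hc, hl, rfl⟩
    exact ⟨d * c, l, mul_ne_zero hd hc, hl, by rw [smul_smul]⟩

lemma inv_real : Inv (F := F) IsRealPair where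
  phi := by
    rintro P Q h a ⟨l1, l2, h1, h2, rfl⟩
    refine ⟨P *ᵥ l1, P *ᵥ l2, ?_, ?_, Phi_mulLin _ _ _⟩
    · rintro ⟨t, ht⟩
      apply h1
      refine ⟨t, ?_⟩
      rw [← mulVec_inv h l2, ht, Matrix.mulVec_smul, mulVec_inv h]
    · rintro ⟨t, ht⟩
      apply h2
      refine ⟨t, ?_⟩
      rw [← mulVec_inv h l1, ht, Matrix.mulVec_smul, mulVec_inv h]
  smul := by
    rintro d hd a ⟨l1, l2, h1, h2, rfl⟩
    refine ⟨d • l1, l2, ?_, ?_, smul_mulLin _ _ _⟩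
    · rintro ⟨t, ht⟩
      exact h1 ⟨t * d, by rw [ht, smul_smul]⟩
    · rintro ⟨t, ht⟩
      refine h2 ⟨d⁻¹ * t, ?_⟩
      rw [← smul_smul, ← ht, smul_smul, inv_mul_cancel₀ hd, one_smul]

lemma disc_smul (c : F) (a : Fin 6 → F) : disc (c • a) = c ^ 3 * disc a := by
  simp [disc]; ring

lemma inv_imag : Inv (F := F) IsImagPair where
  phi := by
    rintro P Q h a ⟨h0, h1⟩
    refine ⟨by rw [disc_Phi, h0, mul_zero], ?_⟩
    rintro ⟨l1, l2, hl⟩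
    apply h1
    refine ⟨Q *ᵥ l1, Q *ᵥ l2, ?_⟩
    rw [← Phi_mulLin, ← hl, Phi_inv h]
  smul := by
    rintro d hd a ⟨h0, h1⟩
    refine ⟨by rw [disc_smul, h0, mul_zero], ?_⟩
    rintro ⟨l1, l2, hl⟩
    apply h1
    refine ⟨d⁻¹ • l1, l2, ?_⟩
    rw [← smul_mulLin, ← hl, smul_smul, inv_mul_cancel₀ hd, one_smul]

lemma inv_nonsing : Inv (F := F) IsNonsingular where
  phi := by
    intro P Q h a h0
    unfold IsNonsingular at *
    rw [disc_Phi]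
    exact mul_ne_zero (pow_ne_zero _ (det_ne h)) h0
  smul := by
    intro d hd a h0
    unfold IsNonsingular at *
    rw [disc_smul]
    exact mul_ne_zero (pow_ne_zero _ hd) h0

/-- Vectors of type `T` in a subspace of conics. -/
def vecs (W : Submodule F (Fin 6 → F)) (T : (Fin 6 → F) → Prop) : Set (Fin 6 → F) :=
  {a | a ≠ 0 ∧ a ∈ W ∧ T a}

lemma card_vecs [Fintype F] (W : Submodule F (Fin 6 → F)) (T : (Fin 6 → F) → Prop)
    (hT : Inv T) : (vecs W T).ncard = numConics W T * (Fintype.card F - 1) := by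
  classical
  have e : {P : Submodule F (Fin 6 → F) |
      ∃ a : Fin 6 → F, a ≠ 0 ∧ a ∈ W ∧ T a ∧ P = Submodule.span F {a}}
      = (fun a => Submodule.span F {a}) '' (vecs W T) := by
    ext P
    constructor
    · rintro ⟨a, h0, h1, h2, rfl⟩
      exact ⟨a, ⟨h0, h1, h2⟩, rfl⟩
    · rintro ⟨a, ⟨h0, h1, h2⟩, rfl⟩
      exact ⟨a, h0, h1, h2, rfl⟩
  rw [numConics, e]
  have hf : (vecs W T).Finite := Set.toFinite _
  obtain ⟨s, hs⟩ := hf.exists_finset_coe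
  rw [← hs, ← Finset.coe_image, Set.ncard_coe_finset, Set.ncard_coe_finset]
  rw [Finset.card_eq_sum_card_image (fun a => Submodule.span F {a}) s]
  apply Finset.sum_const_nat
  intro P hP
  obtain ⟨a, ha, rfl⟩ := Finset.mem_image.1 hP
  have ha' : a ∈ vecs W T := by rw [← hs]; exact ha
  obtain ⟨h0, h1, h2⟩ := ha'
  have : (s.filter fun x => Submodule.span F {x} = Submodule.span F {a})
      = (Finset.univ.erase (0 : F)).image (fun c => c • a) := by
    ext x
    simp only [Finset.mem_filter, Finset.mem_image, Finset.mem_erase, Finset.mem_univ, and_true]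
    constructor
    · rintro ⟨hx, hxa⟩
      have hx' : x ∈ vecs W T := by rw [← hs]; exact hx
      have : x ∈ Submodule.span F {a} := by
        rw [← hxa]; exact Submodule.mem_span_singleton_self x
      obtain ⟨c, rfl⟩ := Submodule.mem_span_singleton.1 this
      refine ⟨c, ?_, rfl⟩
      rintro rfl
      exact hx'.1 (by simp)
    · rintro ⟨c, hc, rfl⟩
      refine ⟨?_, Submodule.span_singleton_smul_eq (IsUnit.mk0 c hc) a⟩
      have : c • a ∈ vecs W T :=
        ⟨smul_ne_zero hc h0, W.smul_mem c h1, hT.smul c hc a h2⟩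
      rw [← hs] at this
      exact this
  rw [this, Finset.card_image_of_injective, Finset.card_erase_of_mem (Finset.mem_univ _),
    Finset.card_univ]
  exact smul_left_injective F h0

lemma exists_basis [Fintype F] (y : Fin 6 → F) (hrk : (M y).rank = 2) (hint : ¬ IsExterior y) :
    ∃ (n : F) (P Q : Matrix (Fin 3) (Fin 3) F), ¬ IsSquare n ∧ P * Q = 1 ∧ Q * P = 1 ∧
      ∀ a, Phi P a ∈ squab y ↔ a 0 = n * a 3 := by
  have han : ∀ v, v ⬝ᵥ (M y *ᵥ v) = 0 → M y *ᵥ v = 0 := by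
    intro v hv
    by_contra h
    exact hint ⟨v, hv, h⟩
  have hdet : (M y).det = 0 := by
    by_contra h
    have := Matrix.rank_of_isUnit (M y) ((Matrix.isUnit_iff_isUnit_det _).2 (IsUnit.mk0 _ h))
    rw [hrk] at this
    simp at this
  obtain ⟨k, hk0, hk⟩ := Matrix.exists_mulVec_eq_zero_iff.2 hdet
  have key : ∀ u : Fin 3 → F, ∃ w, ∀ t : F, M y *ᵥ w ≠ t • u := by
    intro u
    by_contra! h
    have : (M y).rank ≤ 1 := by
      have hle : LinearMap.range (M y).mulVecLin ≤ Submodule.span F {u} := by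
        rintro x ⟨w, rfl⟩
        obtain ⟨t, ht⟩ := h w
        rw [Matrix.mulVecLin_apply, ht]
        exact Submodule.smul_mem _ _ (Submodule.mem_span_singleton_self u)
      exact (Submodule.finrank_mono hle).trans (by
        simpa using finrank_span_le_card (R := F) ({u} : Set (Fin 3 → F)))
    omega
  obtain ⟨v0, hv0⟩ := key 0
  have hv0 : M y *ᵥ v0 ≠ 0 := by simpa using hv0 0
  obtain ⟨w, hw⟩ := key (M y *ᵥ v0)
  set α := v0 ⬝ᵥ (M y *ᵥ v0) with hα
  have hα0 : α ≠ 0 := fun h => hv0 (han _ h)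
  obtain ⟨v1, hv1, h01⟩ : ∃ v1, M y *ᵥ v1 ≠ 0 ∧ v0 ⬝ᵥ (M y *ᵥ v1) = 0 := by
    refine ⟨w - ((v0 ⬝ᵥ (M y *ᵥ w)) / α) • v0, ?_, ?_⟩
    · rw [Matrix.mulVec_sub, Matrix.mulVec_smul, sub_ne_zero]
      exact hw _
    · rw [Matrix.mulVec_sub, Matrix.mulVec_smul, dotProduct_sub, dotProduct_smul, ← hα,
        smul_eq_mul, div_mul_cancel₀ _ hα0, sub_self]
  set β := v1 ⬝ᵥ (M y *ᵥ v1) with hβ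
  have hβ0 : β ≠ 0 := fun h => hv1 (han _ h)
  have h10 : v1 ⬝ᵥ (M y *ᵥ v0) = 0 := by rw [M_symm]; exact h01
  let P : Matrix (Fin 3) (Fin 3) F := (Matrix.of ![v0, v1, k])ᵀ
  have c0 : P.col 0 = v0 := rfl
  have c1 : P.col 1 = v1 := rfl
  have c2 : P.col 2 = k := rfl
  have hP : ∀ x, P *ᵥ x = x 0 • v0 + x 1 • v1 + x 2 • k := by
    intro x
    ext i
    simp [P, Matrix.mulVec, dotProduct, Fin.sum_univ_three]
    ring
  have hPdet : P.det ≠ 0 := by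
    intro h
    obtain ⟨x, hx0, hx⟩ := Matrix.exists_mulVec_eq_zero_iff.2 h
    rw [hP] at hx
    have hM : x 0 • (M y *ᵥ v0) + x 1 • (M y *ᵥ v1) = 0 := by
      have := congrArg (fun z => M y *ᵥ z) hx
      simpa [Matrix.mulVec_add, Matrix.mulVec_smul, hk] using this
    have e0 : x 0 = 0 := by
      have := congrArg (fun z => v0 ⬝ᵥ z) hM
      simp only [dotProduct_add, dotProduct_smul, h01, ← hα, dotProduct_zero] at this
      simpa [hα0] using this
    have e1 : x 1 = 0 := by
      have := congrArg (fun z => v1 ⬝ᵥ z) hM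
      simp only [dotProduct_add, dotProduct_smul, h10, ← hβ, dotProduct_zero] at this
      simpa [hβ0] using this
    have e2 : x 2 = 0 := by
      rw [e0, e1] at hx
      simpa [hk0] using hx
    apply hx0
    ext i
    fin_cases i <;> simp [e0, e1, e2]
  refine ⟨-β / α, P, P⁻¹, ?_, Matrix.mul_nonsing_inv _ (IsUnit.mk0 _ hPdet),
    Matrix.nonsing_inv_mul _ (IsUnit.mk0 _ hPdet), ?_⟩
  · rintro ⟨r, hr⟩
    have hr' : α * (r * r) + β = 0 := by rw [← hr]; field_simp; ring
    have := han (r • v0 + v1) (by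
      simp only [Matrix.mulVec_add, Matrix.mulVec_smul, dotProduct_add, add_dotProduct,
        smul_dotProduct, dotProduct_smul, h01, h10, ← hα, ← hβ, smul_eq_mul]
      linear_combination hr')
    have := congrArg (fun z => v1 ⬝ᵥ z) this
    simp only [Matrix.mulVec_add, Matrix.mulVec_smul, dotProduct_add, dotProduct_smul, h10,
      ← hβ, dotProduct_zero] at this
    exact hβ0 (by simpa using this)
  · intro a
    change Bform _ y = 0 ↔ _
    simp only [Phi, Bform_add, Bform_smul, Bform_mulLin _ _ v0, c0, c1, c2, hk, h01, ← hα, ← hβ,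
      dotProduct_zero]
    constructor
    · intro h
      field_simp
      linear_combination h
    · intro h
      rw [h]
      field_simp
      ring

/-- canonical vectors -/
def cvecs (n : F) (T : (Fin 6 → F) → Prop) : Set (Fin 6 → F) :=
  {a | a ≠ 0 ∧ a 0 = n * a 3 ∧ T a}

lemma reduce [Fintype F] (y : Fin 6 → F) (hrk : (M y).rank = 2) (hint : ¬ IsExterior y) :
    ∃ n : F, ¬ IsSquare n ∧ ∀ T, Inv T → (cvecs n T).ncard = (vecs (squab y) T).ncard := by
  obtain ⟨n, P, Q, hn, hPQ, hQP, h⟩ := exists_basis y hrk hint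
  refine ⟨n, hn, fun T hT => ?_⟩
  have : vecs (squab y) T = Phi P '' cvecs n T := by
    have z : ∀ P : Matrix (Fin 3) (Fin 3) F, Phi P 0 = 0 := by intro P; ext i; simp [Phi]
    ext a
    constructor
    · rintro ⟨h0, h1, h2⟩
      refine ⟨Phi Q a, ⟨?_, ?_, hT.phi Q P hPQ a h2⟩, Phi_inv hPQ a⟩
      · intro h3
        apply h0
        rw [← Phi_inv hPQ a, h3, z]
      · rw [← h, Phi_inv hPQ]; exact h1
    · rintro ⟨a, ⟨h0, h1, h2⟩, rfl⟩
      refine ⟨?_, (h a).2 h1, hT.phi P Q hQP a h2⟩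
      intro h3
      apply h0
      rw [← Phi_inv hQP a, h3, z]
  rw [this, Set.ncard_image_of_injective]
  exact Function.LeftInverse.injective (Phi_inv hQP)
end

section
variable {F : Type} [Field F]

lemma dep_of_cross (b c : Fin 3 → F) (h1 : b 0 * c 1 = b 1 * c 0) (h2 : b 0 * c 2 = b 2 * c 0)
    (h3 : b 1 * c 2 = b 2 * c 1) : (∃ t : F, c = t • b) ∨ (∃ t : F, b = t • c) := by
  by_cases hb : b = 0
  · right
    exact ⟨0, by simp [hb]⟩
  left
  obtain ⟨i, hi⟩ := Function.ne_iff.1 hb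
  have hi' : b i ≠ 0 := hi
  refine ⟨c i / b i, ?_⟩
  ext j
  simp only [Pi.smul_apply, smul_eq_mul]
  rw [div_mul_eq_mul_div, eq_div_iff hi']
  fin_cases i <;> fin_cases j <;> simp <;>
    first | ring1 | linear_combination h1 | linear_combination h2 | linear_combination h3 |
      linear_combination -h1 | linear_combination -h2 | linear_combination -h3

lemma real_of_cross (b c : Fin 3 → F) (h : b 0 * c 1 ≠ b 1 * c 0) :
    IsRealPair (mulLin b c) := by
  refine ⟨b, c, ?_, ?_, rfl⟩
  · rintro ⟨t, rfl⟩
    apply h; simp; ring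
  · rintro ⟨t, rfl⟩
    apply h; simp; ring

lemma D_mulLin (b c : Fin 3 → F) :
    (mulLin b c 1) ^ 2 - 4 * mulLin b c 0 * mulLin b c 3 = (b 0 * c 1 - b 1 * c 0) ^ 2 := by
  simp [mulLin]; ring

lemma D_ne {m : F} (hm : ¬ IsSquare m) (x z : F) (h : x ^ 2 - m * z ^ 2 = 0) : x = 0 ∧ z = 0 := by
  by_cases hz : z = 0
  · subst hz
    simpa using h
  · exfalso
    apply hm
    refine ⟨x / z, ?_⟩
    field_simp
    linear_combination -h

lemma factor (h2 : (2 : F) ≠ 0) {n : F} (hm : ¬ IsSquare (4 * n)) (a : Fin 6 → F)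
    (h0 : a 0 = n * a 3) (hd : disc a = 0) (hsq : IsSquare ((a 1) ^ 2 - 4 * n * (a 3) ^ 2))
    (hne : ¬ (a 1 = 0 ∧ a 3 = 0)) : IsRealPair a := by
  suffices h : ∃ b c, a = mulLin b c by
    obtain ⟨b, c, rfl⟩ := h
    apply real_of_cross
    intro hc
    apply hne
    apply D_ne hm
    have := D_mulLin b c
    rw [hc, h0] at this
    linear_combination this
  obtain ⟨d, hd'⟩ := hsq
  have hd0 : d ≠ 0 := by
    rintro rfl
    exact hne (D_ne hm _ _ (by rw [hd']; ring))
  have hn : n ≠ 0 := by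
    rintro rfl
    exact hm ⟨0, by ring⟩
  unfold disc at hd
  by_cases h3 : a 3 = 0
  · have h1 : a 1 ≠ 0 := fun h => hne ⟨h, h3⟩
    rw [h3, mul_zero] at h0
    refine ⟨![1, 0, a 4 / a 1], ![0, a 1, a 2], ?_⟩
    ext i
    fin_cases i <;> simp [mulLin, h0, h3]
    · field_simp
    · field_simp
      rw [h0, h3] at hd
      apply mul_left_cancel₀ h1
      linear_combination -hd
  · have ha0 : a 0 ≠ 0 := by rw [h0]; exact mul_ne_zero hn h3
    have hD : a 1 ^ 2 - 4 * a 0 * a 3 = d * d := by rw [h0, ← hd']; ring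
    clear hd' h0
    obtain ⟨r, hr⟩ : ∃ r, r = (a 1 - d) / 2 := ⟨_, rfl⟩
    have hr2 : 2 * r = a 1 - d := by rw [hr]; field_simp
    obtain ⟨t, ht⟩ : ∃ t, t = (a 4 - r * a 2 / a 0) / d := ⟨_, rfl⟩
    have ht2 : t * d * a 0 = a 4 * a 0 - r * a 2 := by rw [ht]; field_simp
    have hrs : r * (r + d) = a 0 * a 3 := by
      have h4 : (4 : F) ≠ 0 := by
        have : (4 : F) = 2 * 2 := by norm_num
        rw [this]; exact mul_ne_zero h2 h2
      apply mul_left_cancel₀ h4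
      linear_combination (2 * r + 2 * d + a 1 - d) * hr2 + hD
    have h1 : a 1 = 2 * r + d := by linear_combination -hr2
    refine ⟨![1, r / a 0, t], ![a 0, r + d, a 2 - a 0 * t], ?_⟩
    ext i
    fin_cases i <;> simp [mulLin]
    · field_simp
      linear_combination h1
    · ring
    · field_simp
      linear_combination -hrs
    · field_simp
      linear_combination -ht2
    · skip
      have : a 0 * d ^ 2 ≠ 0 := mul_ne_zero ha0 (pow_ne_zero _ hd0)
      apply mul_left_cancel₀ this
      have e3 : a 0 * a 3 = r * (r + d) := hrs.symm
      have e4 : a 0 * a 4 = t * d * a 0 + r * a 2 := by linear_combination -ht2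
      have hda : a 0 * (4 * a 0 * a 3 * a 5 + a 1 * a 2 * a 4 - a 0 * a 4 ^ 2 - a 3 * a 2 ^ 2
        - a 5 * a 1 ^ 2) = 0 := by rw [hd, mul_zero]
      have hda' : a 0 * (4 * (a 0 * a 3) * a 5) + a 1 * a 2 * (a 0 * a 4) - (a 0 * a 4) ^ 2
        - (a 0 * a 3) * a 2 ^ 2 - a 0 * a 5 * a 1 ^ 2 = 0 := by linear_combination hda
      rw [e3, e4, h1] at hda'
      linear_combination -hda'

/-- Parametrization of the main part. -/
def g (n : F) (x : (F × F) × (F × F) × F) : Fin 6 → F :=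
  ![n * x.1.2, x.1.1, x.2.1.1, x.1.2, x.2.1.2,
    (x.1.2 * (n * x.2.1.2 ^ 2 + x.2.1.1 ^ 2) - x.1.1 * x.2.1.1 * x.2.1.2 + x.2.2) /
      (4 * n * x.1.2 ^ 2 - x.1.1 ^ 2)]

/-- Inverse parametrization. -/
def gi (a : Fin 6 → F) : (F × F) × (F × F) × F := ((a 1, a 3), (a 2, a 4), disc a)

/-- Parametrization of the degenerate part. -/
def kk (x : (F × F) × F) : Fin 6 → F := ![0, 0, x.1.1, 0, x.1.2, x.2]

lemma kk_inj : Function.Injective (kk (F := F)) := by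
  rintro ⟨⟨a, b⟩, c⟩ ⟨⟨a', b'⟩, c'⟩ h
  have h1 := congrFun h 2
  have h2 := congrFun h 4
  have h3 := congrFun h 5
  simp [kk] at h1 h2 h3
  simp [h1, h2, h3]

lemma gi_g {n : F} (hm : ¬ IsSquare (4 * n)) (x : (F × F) × (F × F) × F) (hx : x.1 ≠ 0) :
    gi (g n x) = x := by
  have hD : 4 * n * x.1.2 ^ 2 - x.1.1 ^ 2 ≠ 0 := by
    intro h
    obtain ⟨h1, h2⟩ := D_ne hm x.1.1 x.1.2 (by linear_combination -h)
    exact hx (Prod.ext h1 h2)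
  obtain ⟨⟨a1, a3⟩, ⟨a2, a4⟩, e⟩ := x
  simp only at hD
  simp [gi, g, disc]
  field_simp
  ring

lemma g_gi {n : F} (hm : ¬ IsSquare (4 * n)) (a : Fin 6 → F) (h0 : a 0 = n * a 3)
    (hx : (gi a).1 ≠ 0) : g n (gi a) = a := by
  have hD : 4 * n * a 3 ^ 2 - a 1 ^ 2 ≠ 0 := by
    intro h
    obtain ⟨h1, h2⟩ := D_ne hm (a 1) (a 3) (by linear_combination -h)
    exact hx (Prod.ext h1 h2)
  ext i
  fin_cases i <;> simp [g, gi, h0]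
  rw [div_eq_iff hD, disc, h0]
  ring

lemma g_inj {n : F} (hm : ¬ IsSquare (4 * n)) (S : Set ((F × F) × (F × F) × F))
    (hS : ∀ x ∈ S, x.1 ≠ 0) : Set.InjOn (g n) S := by
  intro x hx z hz h
  rw [← gi_g hm x (hS x hx), h, gi_g hm z (hS z hz)]

lemma kk_eq (a : Fin 6 → F) {n : F} (h0 : a 0 = n * a 3) (hx : (gi a).1 = 0) :
    a = kk ((a 2, a 4), a 5) := by
  have h1 : a 1 = 0 := congrArg Prod.fst hx
  have h3 : a 3 = 0 := congrArg Prod.snd hx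
  ext i
  fin_cases i <;> simp [kk, h0, h1, h3]

lemma disc_kk (x : (F × F) × F) : disc (kk x) = 0 := by simp [disc, kk]

lemma kk_prod (x : (F × F) × F) : kk x = mulLin ![0, 0, 1] ![x.1.1, x.1.2, x.2] := by
  ext i
  fin_cases i <;> simp [kk, mulLin]

lemma kk_zero : kk (0 : (F × F) × F) = 0 := by
  ext i
  fin_cases i <;> simp [kk]

lemma not_real_kk (c : F) : ¬ IsRealPair (kk ((0, 0), c)) := by
  rintro ⟨l1, l2, h1, h2, h⟩
  have e0 := congrFun h 0
  have e1 := congrFun h 1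
  have e2 := congrFun h 2
  have e3 := congrFun h 3
  have e4 := congrFun h 4
  simp [kk, mulLin] at e0 e1 e2 e3 e4
  have d1 : (l1 0 * l2 1 - l1 1 * l2 0) ^ 2 = 0 := by
    have e0' : l1 0 * l2 0 = 0 := by simpa using e0
    linear_combination -(l1 0 * l2 1 + l1 1 * l2 0) * e1 - 4 * (l1 1 * l2 1) * e0'
  have d2 : (l1 0 * l2 2 - l1 2 * l2 0) ^ 2 = 0 := by
    have e0' : l1 0 * l2 0 = 0 := by simpa using e0
    linear_combination -(l1 0 * l2 2 + l1 2 * l2 0) * e2 - 4 * (l1 2 * l2 2) * e0'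
  have d3 : (l1 1 * l2 2 - l1 2 * l2 1) ^ 2 = 0 := by
    have e3' : l1 1 * l2 1 = 0 := by simpa using e3
    linear_combination -(l1 1 * l2 2 + l1 2 * l2 1) * e4 - 4 * (l1 2 * l2 2) * e3'
  rcases dep_of_cross l1 l2 (sub_eq_zero.1 (by simpa using d1)) (sub_eq_zero.1 (by simpa using d2))
    (sub_eq_zero.1 (by simpa using d3)) with h | h
  · exact h1 h
  · exact h2 h

lemma real_kk (x : (F × F) × F) (hx : x.1 ≠ 0) : IsRealPair (kk x) := by
  refine ⟨_, _, ?_, ?_, kk_prod x⟩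
  · rintro ⟨t, ht⟩
    have h0 := congrFun ht 0
    have h1 := congrFun ht 1
    simp at h0 h1
    exact hx (Prod.ext h0 h1)
  · rintro ⟨t, ht⟩
    have h0 := congrFun ht 0
    have h1 := congrFun ht 1
    have h2 := congrFun ht 2
    simp at h0 h1 h2
    rcases h0 with rfl | h0
    · simp at h2
    rcases h1 with rfl | h1
    · simp at h2
    exact hx (Prod.ext h0 h1)

lemma disc_mulLin (b c : Fin 3 → F) : disc (mulLin b c) = 0 := by
  simp [disc, mulLin]; ring

lemma double_disc (a : Fin 6 → F) (h : IsDoubleLine a) :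
    a 1 ^ 2 - 4 * a 0 * a 3 = 0 ∧ a 2 ^ 2 - 4 * a 0 * a 5 = 0 ∧ a 4 ^ 2 - 4 * a 3 * a 5 = 0 := by
  obtain ⟨c, l, hc, hl, rfl⟩ := h
  refine ⟨?_, ?_, ?_⟩ <;> simp [mulLin] <;> ring

lemma cvecs_double {n : F} (hm : ¬ IsSquare (4 * n)) :
    cvecs n IsDoubleLine = kk '' ({0} ×ˢ {0}ᶜ) := by
  ext a
  constructor
  · rintro ⟨hne, h0, h⟩
    obtain ⟨d1, d2, d3⟩ := double_disc a h
    obtain ⟨h1, h3⟩ := D_ne hm (a 1) (a 3) (by rw [h0] at d1; linear_combination d1)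
    have hk := kk_eq a h0 (Prod.ext h1 h3)
    have h2 : a 2 = 0 := by rw [h0, h3] at d2; simpa using d2
    have h4 : a 4 = 0 := by rw [h3] at d3; simpa using d3
    refine ⟨_, ?_, hk.symm⟩
    refine ⟨Prod.ext h2 h4, ?_⟩
    intro h5
    apply hne
    have h5 : a 5 = 0 := h5
    rw [hk, h2, h4, h5]
    exact kk_zero
  · rintro ⟨⟨p, c⟩, ⟨hp, hc⟩, rfl⟩
    have hp : p = 0 := hp
    have hc : c ≠ 0 := hc
    subst hp
    refine ⟨?_, by simp [kk], c, ![0, 0, 1], hc, ?_, ?_⟩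
    · intro h
      rw [← kk_zero] at h
      have := kk_inj h
      exact hc (congrArg Prod.snd this)
    · intro h
      simpa using congrFun h 2
    · ext i
      fin_cases i <;> simp [kk, mulLin]

lemma g_zero (n : F) (x : (F × F) × (F × F) × F) : g n x 0 = n * g n x 3 := by
  simp [g]

lemma g_ne {n : F} (hm : ¬ IsSquare (4 * n)) (x : (F × F) × (F × F) × F) (hx : x.1 ≠ 0) :
    g n x ≠ 0 := by
  intro h
  have := gi_g hm x hx
  rw [h] at this
  apply hx
  rw [← this]
  rfl

lemma disc_g {n : F} (hm : ¬ IsSquare (4 * n)) (x : (F × F) × (F × F) × F) (hx : x.1 ≠ 0) :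
    disc (g n x) = x.2.2 :=
  congrArg (fun z => z.2.2) (gi_g hm x hx)

lemma cvecs_nonsing {n : F} (hm : ¬ IsSquare (4 * n)) :
    cvecs n IsNonsingular = g n '' ({0}ᶜ ×ˢ (Set.univ ×ˢ {0}ᶜ)) := by
  ext a
  constructor
  · rintro ⟨hne, h0, h⟩
    have hx : (gi a).1 ≠ 0 := by
      intro hx
      apply h
      rw [kk_eq a h0 hx, disc_kk]
    exact ⟨gi a, ⟨hx, Set.mem_univ _, h⟩, g_gi hm a h0 hx⟩
  · rintro ⟨x, ⟨hx, -, hd⟩, rfl⟩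
    refine ⟨g_ne hm x hx, g_zero n x, ?_⟩
    unfold IsNonsingular
    rw [disc_g hm x hx]
    exact hd

/-- The norm form. -/
def D (m : F) (p : F × F) : F := p.1 ^ 2 - m * p.2 ^ 2

/-- Nonzero pairs with square norm. -/
def SQ (m : F) : Set (F × F) := {p | p ≠ 0 ∧ IsSquare (D m p)}

/-- Nonzero pairs with nonsquare norm. -/
def NSQ (m : F) : Set (F × F) := {p | p ≠ 0 ∧ ¬ IsSquare (D m p)}

lemma prod_sq {n : F} (a : Fin 6 → F) (h0 : a 0 = n * a 3) (h : ∃ b c, a = mulLin b c) :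
    IsSquare (D (4 * n) (gi a).1) := by
  obtain ⟨b, c, rfl⟩ := h
  refine ⟨b 0 * c 1 - b 1 * c 0, ?_⟩
  have := D_mulLin b c
  rw [h0] at this
  simp only [D, gi]
  linear_combination this

lemma cvecs_imag (h2 : (2 : F) ≠ 0) {n : F} (hm : ¬ IsSquare (4 * n)) :
    cvecs n IsImagPair = g n '' (NSQ (4 * n) ×ˢ (Set.univ ×ˢ {0})) := by
  ext a
  constructor
  · rintro ⟨hne, h0, hd, h⟩
    have hx : (gi a).1 ≠ 0 := by
      intro hx
      apply h
      exact ⟨_, _, (kk_eq a h0 hx).trans (kk_prod _)⟩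
    refine ⟨gi a, ⟨⟨hx, ?_⟩, Set.mem_univ _, hd⟩, g_gi hm a h0 hx⟩
    intro hsq
    obtain ⟨b, c, -, -, hbc⟩ := factor h2 hm a h0 hd hsq (fun hh => hx (Prod.ext hh.1 hh.2))
    exact h ⟨b, c, hbc⟩
  · rintro ⟨x, ⟨⟨hx, hsq⟩, -, hd⟩, rfl⟩
    refine ⟨g_ne hm x hx, g_zero n x, (disc_g hm x hx).trans hd, ?_⟩
    intro h
    apply hsq
    have := prod_sq _ (g_zero n x) h
    rwa [gi_g hm x hx] at this

lemma cvecs_real (h2 : (2 : F) ≠ 0) {n : F} (hm : ¬ IsSquare (4 * n)) :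
    cvecs n IsRealPair = g n '' (SQ (4 * n) ×ˢ (Set.univ ×ˢ {0})) ∪
      kk '' ({0}ᶜ ×ˢ Set.univ) := by
  ext a
  constructor
  · rintro ⟨hne, h0, h⟩
    have hpr : ∃ b c, a = mulLin b c := by
      obtain ⟨b, c, -, -, hbc⟩ := h
      exact ⟨b, c, hbc⟩
    by_cases hx : (gi a).1 = 0
    · right
      refine ⟨_, ⟨?_, Set.mem_univ _⟩, (kk_eq a h0 hx).symm⟩
      intro hp
      have e2 : a 2 = 0 := congrArg Prod.fst hp
      have e4 : a 4 = 0 := congrArg Prod.snd hp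
      rw [kk_eq a h0 hx, e2, e4] at h
      exact not_real_kk _ h
    · left
      refine ⟨gi a, ⟨⟨hx, prod_sq a h0 hpr⟩, Set.mem_univ _, ?_⟩, g_gi hm a h0 hx⟩
      obtain ⟨b, c, rfl⟩ := hpr
      exact disc_mulLin b c
  · rintro (⟨x, ⟨⟨hx, hsq⟩, -, hd⟩, rfl⟩ | ⟨x, ⟨hx, -⟩, rfl⟩)
    · refine ⟨g_ne hm x hx, g_zero n x, ?_⟩
      have e := gi_g hm x hx
      apply factor h2 hm _ (g_zero n x) ((disc_g hm x hx).trans hd)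
      · rw [← e] at hsq
        exact hsq
      · rintro ⟨h1, h3⟩
        apply hx
        rw [← e]
        exact Prod.ext h1 h3
    · refine ⟨?_, by simp [kk], real_kk x hx⟩
      intro h
      rw [← kk_zero] at h
      exact hx (congrArg Prod.fst (kk_inj h))

lemma half [Fintype F] (h2 : (2 : F) ≠ 0) {m : F} (hm : ¬ IsSquare m) :
    2 * (SQ m).ncard = Fintype.card F ^ 2 - 1 ∧ 2 * (NSQ m).ncard = Fintype.card F ^ 2 - 1 := by
  have hD0 : ∀ p : F × F, p ≠ 0 → D m p ≠ 0 := by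
    intro p hp h
    obtain ⟨h1, h2⟩ := D_ne hm p.1 p.2 h
    exact hp (Prod.ext h1 h2)
  obtain ⟨u, hu⟩ : ∃ u : F × F, D m u = m := by
    have hm0 : m ≠ 0 := by rintro rfl; exact hm ⟨0, by simp⟩
    have hodd : Fintype.card F % 2 = 1 := by
      apply FiniteField.odd_card_of_char_ne_two
      intro hc
      apply h2
      have := CharP.cast_eq_zero F (ringChar F)
      rw [hc] at this
      exact_mod_cast this
    obtain ⟨a, b, hab⟩ := FiniteField.exists_root_sum_quadratic
      (f := (Polynomial.X ^ 2 : Polynomial F))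
      (g := Polynomial.C (-m) * Polynomial.X ^ 2 + Polynomial.C 0 * Polynomial.X
        + Polynomial.C (-m))
      (by simp) (Polynomial.degree_quadratic (neg_ne_zero.2 hm0)) hodd
    refine ⟨(a, b), ?_⟩
    simp at hab
    simp only [D]
    linear_combination hab
  let φ : F × F → F × F := fun p => (u.1 * p.1 + m * u.2 * p.2, u.1 * p.2 + u.2 * p.1)
  have hφ : ∀ p, D m (φ p) = m * D m p := by
    intro p
    have h : D m (φ p) = D m u * D m p := by
      simp only [D, φ]
      ring
    rw [h, hu]
  have hm0 : m ≠ 0 := by rintro rfl; exact hm ⟨0, by simp⟩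
  have hinj : Function.Injective φ := by
    intro p r h
    have e1 : u.1 * p.1 + m * u.2 * p.2 = u.1 * r.1 + m * u.2 * r.2 := congrArg Prod.fst h
    have e2 : u.1 * p.2 + u.2 * p.1 = u.1 * r.2 + u.2 * r.1 := congrArg Prod.snd h
    have hu' : u.1 ^ 2 - m * u.2 ^ 2 = m := hu
    apply Prod.ext
    · apply mul_left_cancel₀ hm0
      linear_combination u.1 * e1 - m * u.2 * e2 + (r.1 - p.1) * hu'
    · apply mul_left_cancel₀ hm0
      linear_combination u.1 * e2 - u.2 * e1 + (r.2 - p.2) * hu'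
  have hφ0 : ∀ p, p ≠ 0 → φ p ≠ 0 := by
    intro p hp h
    have := hφ p
    rw [h] at this
    exact mul_ne_zero hm0 (hD0 p hp) (by rw [← this]; simp [D])
  have hmul : ∀ x : F, x ≠ 0 → (IsSquare (m * x) ↔ ¬ IsSquare x) := by
    intro x hx
    constructor
    · rintro ⟨s, hs⟩ ⟨t, ht⟩
      apply hm
      have ht0 : t ≠ 0 := by rintro rfl; exact hx (by simp [ht])
      refine ⟨s / t, ?_⟩
      field_simp
      rw [ht] at hs
      linear_combination hs
    · intro h
      classical
      have h1 := (quadraticChar_neg_one_iff_not_isSquare (F := F)).2 hm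
      have h2 := (quadraticChar_neg_one_iff_not_isSquare (F := F)).2 h
      rw [← quadraticChar_one_iff_isSquare (mul_ne_zero hm0 hx), map_mul, h1, h2]
      norm_num
  have le1 : (SQ m).ncard ≤ (NSQ m).ncard := by
    rw [← Set.ncard_image_of_injective _ hinj]
    apply Set.ncard_le_ncard _ (Set.toFinite _)
    rintro _ ⟨p, ⟨h0, h1⟩, rfl⟩
    refine ⟨hφ0 p h0, ?_⟩
    rw [hφ, hmul _ (hD0 p h0), not_not]
    exact h1
  have le2 : (NSQ m).ncard ≤ (SQ m).ncard := by
    rw [← Set.ncard_image_of_injective _ hinj]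
    apply Set.ncard_le_ncard _ (Set.toFinite _)
    rintro _ ⟨p, ⟨h0, h1⟩, rfl⟩
    refine ⟨hφ0 p h0, ?_⟩
    rw [hφ, hmul _ (hD0 p h0)]
    exact h1
  have hun : SQ m ∪ NSQ m = {0}ᶜ := by
    ext p
    simp only [SQ, NSQ, Set.mem_union, Set.mem_setOf_eq, Set.mem_compl_iff, Set.mem_singleton_iff]
    tauto
  have hdis : Disjoint (SQ m) (NSQ m) := by
    rw [Set.disjoint_left]
    rintro p ⟨_, h⟩ ⟨_, h'⟩
    exact h' h
  have hc := Set.ncard_union_eq hdis (Set.toFinite _) (Set.toFinite _)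
  rw [hun, Set.ncard_compl, Set.ncard_singleton, Nat.card_prod, Nat.card_eq_fintype_card,
    ← sq] at hc
  omega

end
/-- conic counts of a rank-2 interior squab, `q` odd. -/
theorem squab_rank_two_interior_conic_counts (F : Type) [Field F] [Fintype F] (q : ℕ)
    (hq : Fintype.card F = q) (hodd : Odd q) (y : Fin 6 → F) (hy : y ≠ 0)
    (hrk : (M y).rank = 2) (hint : ¬ IsExterior y) :
    numConics (squab y) IsDoubleLine = 1 ∧
    numConics (squab y) IsRealPair = (q ^ 3 + 3 * q ^ 2) / 2 + q ∧
    numConics (squab y) IsImagPair = (q ^ 3 + q ^ 2) / 2 ∧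
    numConics (squab y) IsNonsingular = q ^ 4 - q ^ 2 := by
  have h2 : (2 : F) ≠ 0 := by
    have hc : ringChar F ≠ 2 := by
      intro h
      have := FiniteField.even_card_iff_char_two.1 h
      rw [hq] at this
      obtain ⟨k, hk⟩ := hodd
      omega
    exact Ring.two_ne_zero hc
  obtain ⟨n, hn, hred⟩ := reduce y hrk hint
  have hm : ¬ IsSquare (4 * n) := by
    rintro ⟨r, hr⟩
    apply hn
    refine ⟨r / 2, ?_⟩
    field_simp
    linear_combination hr
  obtain ⟨hs, hns⟩ := half h2 hm
  have cF : Nat.card F = q := by rw [Nat.card_eq_fintype_card, hq]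
  have hq1 : 1 < q := by rw [← hq]; exact Fintype.one_lt_card
  have key : ∀ T, Inv T → numConics (squab y) T * (q - 1) = (cvecs n T).ncard := by
    intro T hT
    rw [hred T hT, card_vecs _ _ hT, hq]
  have k1 := key _ inv_double
  have k2 := key _ inv_real
  have k3 := key _ inv_imag
  have k4 := key _ inv_nonsing
  rw [cvecs_double hm, Set.ncard_image_of_injective _ kk_inj, Set.ncard_prod, Set.ncard_compl,
    Set.ncard_singleton, Set.ncard_singleton, cF] at k1
  rw [cvecs_imag h2 hm, Set.ncard_image_of_injOn (g_inj hm _ (fun x hx => hx.1.1)), Set.ncard_prod,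
    Set.ncard_prod, Set.ncard_univ, Set.ncard_singleton, Nat.card_prod, cF] at k3
  rw [cvecs_nonsing hm, Set.ncard_image_of_injOn (g_inj hm _ (fun x hx => hx.1)), Set.ncard_prod,
    Set.ncard_prod, Set.ncard_univ, Set.ncard_compl, Set.ncard_compl, Set.ncard_singleton,
    Set.ncard_singleton, Nat.card_prod, cF] at k4
  have hdis : Disjoint (g n '' (SQ (4 * n) ×ˢ (Set.univ ×ˢ {0}))) (kk '' ({0}ᶜ ×ˢ Set.univ)) := by
    rw [Set.disjoint_left]
    rintro _ ⟨x, ⟨⟨hx, -⟩, -⟩, rfl⟩ ⟨z, -, hz⟩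
    apply hx
    rw [← gi_g hm x hx, ← hz]
    simp [gi, kk]
  rw [cvecs_real h2 hm, Set.ncard_union_eq hdis (Set.toFinite _) (Set.toFinite _),
    Set.ncard_image_of_injOn (g_inj hm _ (fun x hx => hx.1.1)),
    Set.ncard_image_of_injective _ kk_inj, Set.ncard_prod,
    Set.ncard_prod, Set.ncard_prod, Set.ncard_univ, Set.ncard_univ, Set.ncard_compl,
    Set.ncard_singleton, Set.ncard_singleton, Nat.card_prod, cF] at k2
  rw [hq] at hs hns
  obtain ⟨r, rfl⟩ : ∃ r, q = r + 1 := ⟨q - 1, by omega⟩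
  have hr : 0 < r := by omega
  have e1 : (r + 1) ^ 2 - 1 = r * (r + 2) := by
    rw [Nat.sub_eq_iff_eq_add (Nat.one_le_pow _ _ (by omega))]; ring
  have e1' : (r + 1) * (r + 1) - 1 = r * (r + 2) := by rw [← sq]; exact e1
  rw [e1] at hs hns
  simp only [e1', Nat.add_sub_cancel, one_mul, mul_one] at k1 k2 k3 k4
  refine ⟨?_, ?_, ?_, ?_⟩
  · apply Nat.eq_of_mul_eq_mul_right hr
    rw [k1]; ring
  · have h : 2 * numConics (squab y) IsRealPair = (r + 1) ^ 3 + 3 * (r + 1) ^ 2 + 2 * (r + 1) := by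
      apply Nat.eq_of_mul_eq_mul_right hr
      rw [mul_assoc, k2, mul_add, ← mul_assoc, hs]
      ring
    omega
  · have h : 2 * numConics (squab y) IsImagPair = (r + 1) ^ 3 + (r + 1) ^ 2 := by
      apply Nat.eq_of_mul_eq_mul_right hr
      rw [mul_assoc, k3, ← mul_assoc, hns]
      ring
    omega
  · have h : numConics (squab y) IsNonsingular + (r + 1) ^ 2 = (r + 1) ^ 4 := by
      apply Nat.eq_of_mul_eq_mul_right hr
      rw [add_mul, k4]
      ring
    omega
end Conics
end
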